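/- arXiv:1802.00979 — 2 statements merged into one kernel-verified Lean document; each statement's English description precedes it below -/
import Mathlib

section
/- Let V be a nontrivial locally finite variety of lattices distinct from the variety of all lattices and from the variety of all distributive lattices. Then no reasonable order expansion of V^fin that has the joint embedding property has the Ramsey property. -/
/-- A lattice viewed as an algebra `(L, ∧, ∨)`. -/
structure BLat : Type 1 where
  carrier : Type
  latt : Lattice carrier

/-- A lattice homomorphism: preserves meet and join. -/
def IsLatHom (A B : BLat) (f : A.carrier → B.carrier) : Prop :=
  letI := A.latt
  letI := B.latt
  (∀ a b, f (a ⊓ b) = f a ⊓ f b) ∧ (∀ a b, f (a ⊔ b) = f a ⊔ f b)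

/-- The product of a family of lattices. -/
def prodBLat (ι : Type) (F : ι → BLat) : BLat :=
  ⟨∀ i, (F i).carrier, @Pi.instLattice _ _ (fun i => (F i).latt)⟩

/-- A variety of lattices: a class of lattices closed under homomorphic images,
sublattices, and products of arbitrary families of its members. -/
def IsLatVariety (V : BLat → Prop) : Prop :=
  (∀ A, V A → ∀ (B : BLat) (f : A.carrier → B.carrier),
      Function.Surjective f → IsLatHom A B f → V B) ∧
  (∀ A, V A → ∀ (B : BLat) (f : B.carrier → A.carrier),
      Function.Injective f → IsLatHom B A f → V B) ∧
  (∀ (ι : Type) (F : ι → BLat), (∀ i, V (F i)) → V (prodBLat ι F))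

/-- A class of lattices is nontrivial if it contains a lattice with at least two
elements. -/
def LatNontrivial (V : BLat → Prop) : Prop :=
  ∃ A, V A ∧ ∃ a b : A.carrier, a ≠ b

/-- A finite lattice expanded by a linear order (not necessarily related to the
lattice order). -/
structure OLat : Type 1 where
  carrier : Type
  finite : Finite carrier
  latt : Lattice carrier
  lt : carrier → carrier → Prop
  sto : IsStrictTotalOrder carrier lt

/-- The lattice reduct of an ordered lattice. -/
def OLat.toBLat (M : OLat) : BLat := ⟨M.carrier, M.latt⟩

/-- Embeddings of linearly ordered lattices: injective lattice homomorphisms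
preserving and reflecting the linear order. -/
def OLat.IsEmb (A B : OLat) (f : A.carrier → B.carrier) : Prop :=
  Function.Injective f ∧ IsLatHom A.toBLat B.toBLat f ∧
    ∀ a b, A.lt a b ↔ B.lt (f a) (f b)

/-- `W` is an order expansion of the class of finite members of `V`: members of
`W` are finite lattices of `V` with a linear order, and every finite lattice of
`V` carries at least one linear order putting it in `W`. -/
def OLatExpansion (W : OLat → Prop) (V : BLat → Prop) : Prop :=
  (∀ M, W M → V M.toBLat) ∧
  (∀ (L : BLat) (h : Finite L.carrier), V L →
    ∃ (lt : L.carrier → L.carrier → Prop) (sto : IsStrictTotalOrder L.carrier lt),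
      W ⟨L.carrier, h, L.latt, lt, sto⟩)

/-- `W` is a reasonable expansion: any linear order on the domain of a lattice
embedding (whose ordered version lies in `W`) can be transported along the
embedding to a linear order on the codomain keeping the map an embedding of
ordered lattices. -/
def OLatReasonable (W : OLat → Prop) (V : BLat → Prop) : Prop :=
  ∀ (A B : BLat) (hA : Finite A.carrier) (hB : Finite B.carrier),
    V A → V B →
    ∀ f : A.carrier → B.carrier, Function.Injective f → IsLatHom A B f →
    ∀ lt sto, W ⟨A.carrier, hA, A.latt, lt, sto⟩ →
      ∃ lt' sto', W ⟨B.carrier, hB, B.latt, lt', sto'⟩ ∧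
        ∀ a b, lt a b ↔ lt' (f a) (f b)

/-- The joint embedding property for a class of ordered lattices. -/
def OLatJEP (W : OLat → Prop) : Prop :=
  ∀ A B, W A → W B → ∃ C, W C ∧ (∃ f, OLat.IsEmb A C f) ∧ ∃ g, OLat.IsEmb B C g

/-- `S` is (the underlying set of) a substructure of `C` isomorphic to `A`. -/
def OLat.IsCopy (A C : OLat) (S : Set C.carrier) : Prop :=
  ∃ f, OLat.IsEmb A C f ∧ Set.range f = S

/-- `C ⟶ (B)^A_k` for ordered lattices. -/
def OLat.Arrows (C B A : OLat) (k : ℕ) : Prop :=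
  ∀ χ : Set C.carrier → Fin k,
    ∃ Bt : Set C.carrier, OLat.IsCopy B C Bt ∧ ∃ j : Fin k,
      ∀ S : Set C.carrier, OLat.IsCopy A C S → S ⊆ Bt → χ S = j

/-- The Ramsey property for a class of finite ordered lattices. -/
def OLatRamsey (W : OLat → Prop) : Prop :=
  ∀ A B, W A → W B → (∃ f, OLat.IsEmb A B f) → ∀ k : ℕ, 2 ≤ k →
    ∃ C, W C ∧ OLat.Arrows C B A k

/-- The sublattice of `L` generated by `S`. -/
def latClosure (L : BLat) (S : Set L.carrier) : Set L.carrier :=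
  letI := L.latt
  ⋂₀ {T : Set L.carrier | S ⊆ T ∧ ∀ a ∈ T, ∀ b ∈ T, a ⊓ b ∈ T ∧ a ⊔ b ∈ T}

/-- A class of lattices is locally finite if every finitely generated
sublattice of each of its members is finite. -/
def LatLocallyFinite (V : BLat → Prop) : Prop :=
  ∀ L, V L → ∀ S : Set L.carrier, S.Finite → (latClosure L S).Finite

/-- The variety of all lattices. -/
def LatAll : BLat → Prop := fun _ => True

/-- The variety of all distributive lattices. -/
def LatDistrib : BLat → Prop := fun L =>
  letI := L.latt
  ∀ a b c : L.carrier, a ⊓ (b ⊔ c) = (a ⊓ b) ⊔ (a ⊓ c)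

/-- Two order embeddings of a finite linearly ordered lattice with the same range coincide. -/
theorem OLat.IsEmb.eq_of_range_eq {A C : OLat} {f g : A.carrier → C.carrier}
    (hf : OLat.IsEmb A C f) (hg : OLat.IsEmb A C g) (h : Set.range f = Set.range g) : f = g := by
  have := A.finite
  have := A.sto
  have : IsWellOrder A.carrier A.lt :=
    { wf := Finite.wellFounded_of_trans_of_irrefl A.lt }
  have hex : ∀ a, ∃ b, g b = f a := fun a => by
    have : f a ∈ Set.range g := h ▸ Set.mem_range_self a
    exact this
  choose s hs using hex
  have hinj : Function.Injective s := fun a b hab => hf.1 (by rw [← hs a, ← hs b, hab])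
  have hbij : Function.Bijective s := hinj.bijective_of_finite
  let e : A.lt ≃r A.lt :=
    { toEquiv := Equiv.ofBijective s hbij
      map_rel_iff' := fun {a b} => by
        change A.lt (s a) (s b) ↔ A.lt a b
        rw [hg.2.2, hs, hs, ← hf.2.2] }
  funext a
  have : s a = a := InitialSeg.eq e.toInitialSeg (RelIso.refl A.lt).toInitialSeg a
  rw [← hs a, this]

theorem IsLatHom.comp {A B C : BLat} {g : B.carrier → C.carrier} {f : A.carrier → B.carrier}
    (hg : IsLatHom B C g) (hf : IsLatHom A B f) : IsLatHom A C (g ∘ f) :=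
  ⟨fun a b => (congrArg g (hf.1 a b)).trans (hg.1 _ _),
    fun a b => (congrArg g (hf.2 a b)).trans (hg.2 _ _)⟩

theorem OLat.IsEmb.comp {A B C : OLat} {g : B.carrier → C.carrier} {f : A.carrier → B.carrier}
    (hg : OLat.IsEmb B C g) (hf : OLat.IsEmb A B f) : OLat.IsEmb A C (g ∘ f) :=
  ⟨hg.1.comp hf.1, hg.2.1.comp hf.2.1, fun a b => (hf.2.2 a b).trans (hg.2.2 _ _)⟩

/-- The joint embedding property and the Ramsey property imply the amalgamation property. -/
theorem OLatRamsey.amalgamation {W : OLat → Prop} (hR : OLatRamsey W) (hjep : OLatJEP W)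
    {A B₁ B₂ : OLat} (hA : W A) (hB₁ : W B₁) (hB₂ : W B₂)
    {f₁ : A.carrier → B₁.carrier} {f₂ : A.carrier → B₂.carrier}
    (hf₁ : OLat.IsEmb A B₁ f₁) (hf₂ : OLat.IsEmb A B₂ f₂) :
    ∃ C, W C ∧ ∃ g₁ g₂, OLat.IsEmb B₁ C g₁ ∧ OLat.IsEmb B₂ C g₂ ∧ g₁ ∘ f₁ = g₂ ∘ f₂ := by
  classical
  obtain ⟨D, hD, ⟨d₁, hd₁⟩, d₂, hd₂⟩ := hjep B₁ B₂ hB₁ hB₂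
  obtain ⟨C, hC, hCD⟩ := hR A D hA hD ⟨_, hd₁.comp hf₁⟩ 2 le_rfl
  let P : Set C.carrier → Prop := fun S =>
    ∃ g, OLat.IsEmb B₁ C g ∧ Set.range (g ∘ f₁) = S
  obtain ⟨T, ⟨e, he, rfl⟩, j, hj⟩ := hCD (fun S => if P S then 0 else 1)
  have h₁ := hj (Set.range (e ∘ d₁ ∘ f₁)) ⟨_, he.comp (hd₁.comp hf₁), rfl⟩
    (Set.range_comp_subset_range _ _)
  have h₂ := hj (Set.range (e ∘ d₂ ∘ f₂)) ⟨_, he.comp (hd₂.comp hf₂), rfl⟩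
    (Set.range_comp_subset_range _ _)
  have hP₁ : P (Set.range (e ∘ d₁ ∘ f₁)) := ⟨e ∘ d₁, he.comp hd₁, rfl⟩
  have hP₂ : P (Set.range (e ∘ d₂ ∘ f₂)) := by
    by_contra hn
    rw [if_pos hP₁] at h₁
    rw [if_neg hn, ← h₁] at h₂
    exact absurd h₂ (by decide)
  obtain ⟨g, hg, hr⟩ := hP₂
  exact ⟨C, hC, g, e ∘ d₂, hg, he.comp hd₂,
    (hg.comp hf₁).eq_of_range_eq (he.comp (hd₂.comp hf₂)) hr⟩

/-- If a class `V` of lattices has a reasonable order expansion with the joint embedding property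
and the Ramsey property, then the finite members of `V` have the amalgamation property. -/
theorem OLatRamsey.exists_amalgam {V : BLat → Prop} {W : OLat → Prop}
    (hR : OLatRamsey W) (hexp : OLatExpansion W V) (hreas : OLatReasonable W V)
    (hjep : OLatJEP W) {A B₁ B₂ : Type} [Lattice A] [Lattice B₁] [Lattice B₂]
    [Finite A] [Finite B₁] [Finite B₂] (hA : V ⟨A, inferInstance⟩)
    (hB₁ : V ⟨B₁, inferInstance⟩) (hB₂ : V ⟨B₂, inferInstance⟩)
    (f₁ : LatticeHom A B₁) (f₂ : LatticeHom A B₂)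
    (hf₁ : Function.Injective f₁) (hf₂ : Function.Injective f₂) :
    ∃ (C : Type) (_ : Lattice C), V ⟨C, inferInstance⟩ ∧
      ∃ (g₁ : LatticeHom B₁ C) (g₂ : LatticeHom B₂ C), Function.Injective g₁ ∧
        ∀ a, g₁ (f₁ a) = g₂ (f₂ a) := by
  obtain ⟨lt, sto, hWA⟩ := hexp.2 ⟨A, inferInstance⟩ ‹_› hA
  have hom₁ : IsLatHom ⟨A, inferInstance⟩ ⟨B₁, inferInstance⟩ f₁ := ⟨map_inf f₁, map_sup f₁⟩
  have hom₂ : IsLatHom ⟨A, inferInstance⟩ ⟨B₂, inferInstance⟩ f₂ := ⟨map_inf f₂, map_sup f₂⟩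
  obtain ⟨lt₁, sto₁, hW₁, hlt₁⟩ := hreas _ _ ‹Finite A› ‹Finite B₁› hA hB₁ f₁ hf₁ hom₁ lt sto hWA
  obtain ⟨lt₂, sto₂, hW₂, hlt₂⟩ := hreas _ _ ‹Finite A› ‹Finite B₂› hA hB₂ f₂ hf₂ hom₂ lt sto hWA
  obtain ⟨C, hC, g₁, g₂, hg₁, hg₂, hg⟩ := hR.amalgamation hjep hWA hW₁ hW₂
    (f₁ := f₁) (f₂ := f₂) ⟨hf₁, hom₁, hlt₁⟩ ⟨hf₂, hom₂, hlt₂⟩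
  let := C.latt
  exact ⟨C.carrier, C.latt, hexp.1 C hC,
    ⟨⟨g₁, hg₁.2.1.2⟩, hg₁.2.1.1⟩, ⟨⟨g₂, hg₂.2.1.2⟩, hg₂.2.1.1⟩, hg₁.1, congrFun hg⟩

/-- A nontrivial variety of lattices contains every distributive lattice. -/
theorem IsLatVariety.of_latDistrib {V : BLat → Prop} (hvar : IsLatVariety V)
    (hnt : LatNontrivial V) {L : BLat} (hL : LatDistrib L) : V L := by
  classical
  obtain ⟨⟨A, instA⟩, hA, a, b, hab⟩ := hnt
  obtain ⟨L, instL⟩ := L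
  change A at a b
  let instD : DistribLattice L := DistribLattice.ofInfSupLe fun x y z => (hL x y z).le
  have hlt : a ⊓ b < a ⊔ b := inf_lt_sup.2 hab
  refine hvar.2.1 _ (hvar.2.2 {J : Order.Ideal L // J.IsPrime} (fun _ => ⟨A, instA⟩)
    fun _ => hA) ⟨L, instL⟩ (fun x J => if x ∈ J.1 then a ⊓ b else a ⊔ b) ?_ ⟨?_, ?_⟩
  · have key : ∀ x y : L, ¬ x ≤ y →
        ∃ J : Order.Ideal L, J.IsPrime ∧ y ∈ J ∧ x ∉ J := fun x y hxy => by
      obtain ⟨J, hJ, hle, hdis⟩ := DistribLattice.prime_ideal_of_disjoint_filter_ideal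
        (F := Order.PFilter.principal x) (I := Order.Ideal.principal y)
        (Set.disjoint_left.2 fun z hz hz' => hxy (le_trans hz hz'))
      exact ⟨J, hJ, hle (Order.Ideal.mem_principal_self),
        Set.disjoint_left.1 hdis (show x ∈ Order.PFilter.principal x from le_rfl)⟩
    intro x y hxy
    have hle : ∀ x y : L, (∀ J : {J : Order.Ideal L // J.IsPrime},
        (if x ∈ J.1 then a ⊓ b else a ⊔ b) = if y ∈ J.1 then a ⊓ b else a ⊔ b) → x ≤ y := by
      intro x y h
      by_contra hn
      obtain ⟨J, hJ, hy, hx⟩ := key x y hn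
      have := h ⟨J, hJ⟩
      rw [if_neg hx, if_pos hy] at this
      exact hlt.ne' this
    exact le_antisymm (hle x y fun J => congrFun hxy J) (hle y x fun J => (congrFun hxy J).symm)
  · intro x y
    funext J
    change (if x ⊓ y ∈ J.1 then a ⊓ b else a ⊔ b) =
      (if x ∈ J.1 then a ⊓ b else a ⊔ b) ⊓ (if y ∈ J.1 then a ⊓ b else a ⊔ b)
    have h : x ⊓ y ∈ J.1 ↔ x ∈ J.1 ∨ y ∈ J.1 :=
      ⟨J.2.mem_or_mem, fun h => h.elim (J.1.lower inf_le_left) (J.1.lower inf_le_right)⟩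
    by_cases hx : x ∈ J.1 <;> by_cases hy : y ∈ J.1 <;> simp [h, hx, hy, hlt.le]
  · intro x y
    funext J
    change (if x ⊔ y ∈ J.1 then a ⊓ b else a ⊔ b) =
      (if x ∈ J.1 then a ⊓ b else a ⊔ b) ⊔ (if y ∈ J.1 then a ⊓ b else a ⊔ b)
    have h : x ⊔ y ∈ J.1 ↔ x ∈ J.1 ∧ y ∈ J.1 := Order.Ideal.sup_mem_iff
    by_cases hx : x ∈ J.1 <;> by_cases hy : y ∈ J.1 <;> simp [h, hx, hy, hlt.le]

/-- The polynomial function `x ↦ x ⊔ ((x ⊔ p) ⊓ q)`. -/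
def latPoly {L : Type} [Lattice L] (p q x : L) : L := x ⊔ ((x ⊔ p) ⊓ q)

theorem map_latPoly {L M : Type} [Lattice L] [Lattice M] (f : LatticeHom L M) (p q x : L) :
    f (latPoly p q x) = latPoly (f p) (f q) (f x) := by
  simp [latPoly]

/-- In a nondistributive lattice, some `latPoly p q` fixes `o` and `t` and moves
some `a ∈ [o, t)` to `t`. -/
theorem exists_latPoly_of_not_distrib {L : Type} [Lattice L]
    (h : ¬ ∀ a b c : L, a ⊓ (b ⊔ c) = (a ⊓ b) ⊔ (a ⊓ c)) :
    ∃ p q o a t : L, o ≤ a ∧ a < t ∧ latPoly p q o = o ∧ latPoly p q a = t ∧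
      latPoly p q t = t := by
  have hex : ∃ q p x : L, ¬ q ⊓ (p ⊔ x) ≤ x ⊔ q ⊓ p := by
    by_contra! hcon
    refine h fun a b c => le_antisymm ?_ le_inf_sup
    calc a ⊓ (b ⊔ c) ≤ a ⊓ (c ⊔ a ⊓ b) := le_inf inf_le_left (hcon a b c)
      _ ≤ a ⊓ b ⊔ a ⊓ c := hcon a c (a ⊓ b)
  obtain ⟨q, p, x, hqpx⟩ := hex
  have hp : x ⊔ q ⊓ p ⊔ p = x ⊔ p := by
    rw [sup_assoc, sup_eq_right.2 (inf_le_right : q ⊓ p ≤ p)]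
  have hat : x ⊔ q ⊓ p < latPoly p q (x ⊔ q ⊓ p) := by
    refine left_lt_sup.2 fun hle => hqpx ?_
    rwa [hp, inf_comm, sup_comm x p] at hle
  refine ⟨p, q, q ⊓ p, x ⊔ q ⊓ p, latPoly p q (x ⊔ q ⊓ p), le_sup_right, hat, ?_, rfl, ?_⟩
  · simp [latPoly, inf_comm]
  · have : latPoly p q (x ⊔ q ⊓ p) ⊔ p = x ⊔ q ⊓ p ⊔ p :=
      le_antisymm (sup_le (sup_le le_sup_left inf_le_left) le_sup_right)
        (sup_le_sup_right le_sup_left _)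
    rw [latPoly, this]
    exact sup_eq_left.2 le_sup_right

theorem subset_latClosure (L : BLat) (S : Set L.carrier) : S ⊆ latClosure L S :=
  Set.subset_sInter fun _ hT => hT.1

/-- The sublattice generated by a set, as a bundled sublattice. -/
def latClosureSublattice {L : Type} [Lattice L] (S : Set L) : Sublattice L where
  carrier := latClosure ⟨L, inferInstance⟩ S
  supClosed' := fun _ ha _ hb =>
    Set.mem_sInter.2 fun _ hT => (hT.2 _ (ha _ hT) _ (hb _ hT)).2
  infClosed' := fun _ ha _ hb =>
    Set.mem_sInter.2 fun _ hT => (hT.2 _ (ha _ hT) _ (hb _ hT)).1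

theorem IsLatVariety.of_injective {V : BLat → Prop} (hvar : IsLatVariety V) {A B : Type}
    [Lattice A] [Lattice B] (hB : V ⟨B, inferInstance⟩) (f : LatticeHom A B)
    (hf : Function.Injective f) : V ⟨A, inferInstance⟩ :=
  hvar.2.1 _ hB ⟨A, inferInstance⟩ f hf ⟨map_inf f, map_sup f⟩

/-- A locally finite variety with a nondistributive member has a finite nondistributive member. -/
theorem LatLocallyFinite.exists_finite_not_distrib {V : BLat → Prop} (hvar : IsLatVariety V)
    (hlf : LatLocallyFinite V) {B : BLat} (hB : V B) (h : ¬ LatDistrib B) :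
    ∃ (L : Type) (_ : Lattice L), Finite L ∧ V ⟨L, inferInstance⟩ ∧
      ¬ ∀ a b c : L, a ⊓ (b ⊔ c) = (a ⊓ b) ⊔ (a ⊓ c) := by
  obtain ⟨B, instB⟩ := B
  change ¬ ∀ a b c : B, a ⊓ (b ⊔ c) = (a ⊓ b) ⊔ (a ⊓ c) at h
  push Not at h
  obtain ⟨a, b, c, h⟩ := h
  have hS := subset_latClosure ⟨B, instB⟩ {a, b, c}
  refine ⟨latClosureSublattice {a, b, c}, inferInstance,
    (hlf ⟨B, instB⟩ hB {a, b, c} (Set.toFinite _)).to_subtype,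
    hvar.of_injective hB (latClosureSublattice {a, b, c}).subtype Subtype.val_injective, ?_⟩
  intro hd
  exact h (congrArg Subtype.val
    (hd ⟨a, hS (by simp)⟩ ⟨b, hS (by simp)⟩ ⟨c, hS (by simp)⟩))

/-- The `i`-th coordinate of the `j`-th element of an ascending chain in a power of a lattice, in
which the step from `j` to `j + 1` with `j` of the parity of `e` goes from `a` to `t` in
coordinate `j`. -/
def parityChain {L : Type} (o a t : L) (e i j : ℕ) : L :=
  if i % 2 = e % 2 then (if j < i then o else if j = i then a else t)
  else if j ≤ i then o else t

section parityChain

variable {L : Type} [Lattice L] {p q o a t : L}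

theorem parityChain_mono (hoa : o ≤ a) (hat : a < t) (e i : ℕ) :
    Monotone (parityChain o a t e i) := by
  have hot := hoa.trans hat.le
  have := hat.le
  intro j k hjk
  unfold parityChain
  split_ifs <;> first | omega | simp [*]

theorem parityChain_ne (hoa : o ≤ a) (hat : a < t) (e : ℕ) {j k : ℕ} (hjk : j < k) :
    parityChain o a t e j j ≠ parityChain o a t e j k := by
  have hat' := hat.ne
  have hot := (hoa.trans_lt hat).ne
  unfold parityChain
  split_ifs <;> omega

theorem parityChain_succ (hoa : o ≤ a) (hat : a < t) (ho : latPoly p q o = o)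
    (ha : latPoly p q a = t) (ht : latPoly p q t = t) {e i j : ℕ} (hj : j % 2 = e % 2) :
    latPoly (if i % 2 = e % 2 then p else o) (if i % 2 = e % 2 then q else o)
      (parityChain o a t e i j) = parityChain o a t e i (j + 1) := by
  have h₁ : latPoly o o o = o := by simp [latPoly]
  have h₂ : latPoly o o t = t := by simp [latPoly, hoa.trans hat.le]
  unfold parityChain
  split_ifs <;> omega

/-- The first `n + 1` elements of the chain `parityChain`, in a finite power of the lattice. -/
def parityChainHom (hoa : o ≤ a) (hat : a < t) (e n : ℕ) :
    LatticeHom (Fin (n + 1)) (Fin (n + 1) → L) where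
  toFun j i := parityChain o a t e i j
  map_sup' j k := by
    funext i
    exact ((parityChain_mono hoa hat e i).comp Fin.val_strictMono.monotone).map_sup j k
  map_inf' j k := by
    funext i
    exact ((parityChain_mono hoa hat e i).comp Fin.val_strictMono.monotone).map_inf j k

theorem parityChainHom_injective (hoa : o ≤ a) (hat : a < t) (e n : ℕ) :
    Function.Injective (parityChainHom hoa hat e n) := by
  have key : ∀ j k : Fin (n + 1), j < k →
      parityChainHom hoa hat e n j ≠ parityChainHom hoa hat e n k :=
    fun j k hjk h => parityChain_ne hoa hat e hjk (congrFun h j)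
  intro j k h
  by_contra hne
  rcases lt_or_gt_of_ne hne with hlt | hlt
  · exact key _ _ hlt h
  · exact key _ _ hlt h.symm

end parityChain

/-- If a variety with a finite nondistributive member has a reasonable Ramsey order expansion with
the joint embedding property, then five elements of a member of the variety can generate an
arbitrarily long chain. -/
theorem OLatRamsey.exists_long_chain {V : BLat → Prop} {W : OLat → Prop}
    (hvar : IsLatVariety V) (hR : OLatRamsey W) (hexp : OLatExpansion W V)
    (hreas : OLatReasonable W V) (hjep : OLatJEP W) {L : Type} [Lattice L] [Finite L]
    (hL : V ⟨L, inferInstance⟩) (hd : ¬ ∀ a b c : L, a ⊓ (b ⊔ c) = (a ⊓ b) ⊔ (a ⊓ c)) (n : ℕ) :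
    ∃ (M : Type) (_ : Lattice M), V ⟨M, inferInstance⟩ ∧ ∃ (p q : Bool → M) (x : ℕ → M),
      (∀ j < n, x j ≠ x n) ∧
        ∀ j < n, x (j + 1) = latPoly (p (j % 2 == 0)) (q (j % 2 == 0)) (x j) := by
  obtain ⟨p, q, o, a, t, hoa, hat, ho, ha, ht⟩ := exists_latPoly_of_not_distrib hd
  have hP : V ⟨Fin (n + 1) → L, inferInstance⟩ :=
    hvar.2.2 (Fin (n + 1)) (fun _ => ⟨L, inferInstance⟩) fun _ => hL
  have hinj := parityChainHom_injective (L := L) hoa hat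
  obtain ⟨M, instM, hM, g₀, g₁, hg, heq⟩ := hR.exists_amalgam hexp hreas hjep
    (hvar.of_injective hP _ (hinj 0 n)) hP hP _ _ (hinj 0 n) (hinj 1 n)
  let c : ℕ → L → Fin (n + 1) → L := fun e r i => if (i : ℕ) % 2 = e % 2 then r else o
  let x : ℕ → M := fun j => g₀ (parityChainHom hoa hat 0 n (Fin.ofNat (n + 1) j))
  have hval : ∀ j ≤ n, ((Fin.ofNat (n + 1) j : Fin (n + 1)) : ℕ) = j := fun j hj =>
    Nat.mod_eq_of_lt (Nat.lt_succ_of_le hj)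
  have hstep : ∀ e j, j < n → j % 2 = e % 2 →
      latPoly (c e p) (c e q) (parityChainHom hoa hat e n (Fin.ofNat (n + 1) j)) =
        parityChainHom hoa hat e n (Fin.ofNat (n + 1) (j + 1)) := by
    intro e j hj hje
    funext i
    have := parityChain_succ hoa hat ho ha ht (i := i) hje
    change latPoly (c e p i) (c e q i) (parityChain o a t e i (Fin.ofNat (n + 1) j : Fin (n + 1)))
      = parityChain o a t e i (Fin.ofNat (n + 1) (j + 1) : Fin (n + 1))
    rw [hval j hj.le, hval (j + 1) hj]
    exact this
  refine ⟨M, instM, hM, fun b => if b then g₀ (c 0 p) else g₁ (c 1 p),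
    fun b => if b then g₀ (c 0 q) else g₁ (c 1 q), x, ?_, ?_⟩
  · intro j hj h
    have := congrArg Fin.val (hinj 0 n (hg h))
    rw [hval j hj.le, hval n le_rfl] at this
    exact hj.ne this
  · intro j hj
    rcases Nat.mod_two_eq_zero_or_one j with h | h
    · simp only [x, ← hstep 0 j hj h, map_latPoly, h]
      rfl
    · simp only [x, heq, ← hstep 1 j hj h, map_latPoly, h]
      rfl

/-- Let `V` be a nontrivial locally finite variety of lattices distinct from the
variety of all lattices and from the variety of all distributive lattices. Then
no reasonable order expansion of `V^fin` with the joint embedding property has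
the Ramsey property. -/
theorem stmt_0 (V : BLat → Prop) (hvar : IsLatVariety V)
    (hnt : LatNontrivial V) (hlf : LatLocallyFinite V)
    (hL : V ≠ LatAll) (hD : V ≠ LatDistrib)
    (W : OLat → Prop) (hexp : OLatExpansion W V)
    (hreas : OLatReasonable W V) (hjep : OLatJEP W) :
    ¬ OLatRamsey W := by
  intro hR
  obtain ⟨B, hB, hBd⟩ : ∃ B, V B ∧ ¬ LatDistrib B := by
    by_contra! hcon
    exact hD (funext fun B => propext ⟨hcon B, fun h => hvar.of_latDistrib hnt h⟩)
  obtain ⟨L, instL, hfin, hLV, hLd⟩ := hlf.exists_finite_not_distrib hvar hB hBd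
  choose M instM hM p q x hne hx using
    hR.exists_long_chain hvar hexp hreas hjep hLV hLd
  let P : Bool → ∀ n, M n := fun b n => p n b
  let Q : Bool → ∀ n, M n := fun b n => q n b
  let Y : ℕ → ∀ n, M n := fun j => Nat.rec (fun n => x n 0)
    (fun j y => latPoly (P (j % 2 == 0)) (Q (j % 2 == 0)) y) j
  have hY : ∀ n j, j ≤ n → Y j n = x n j := by
    intro n j
    induction j with
    | zero => exact fun _ => rfl
    | succ j ih =>
      intro hj
      rw [hx n j hj, ← ih (Nat.le_of_succ_le hj)]
      rfl
  have hYinj : Function.Injective Y := by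
    have key : ∀ j k, j < k → Y j ≠ Y k := fun j k hjk h => hne k j hjk <| by
      rw [← hY k j hjk.le, ← hY k k le_rfl, h]
    intro j k h
    by_contra hjk
    rcases lt_or_gt_of_ne hjk with hlt | hlt
    · exact key _ _ hlt h
    · exact key _ _ hlt h.symm
  let S : Set (∀ n, M n) := Set.range P ∪ Set.range Q ∪ {Y 0}
  have hprod : V ⟨∀ n, M n, inferInstance⟩ :=
    hvar.2.2 ℕ (fun n => ⟨M n, instM n⟩) hM
  have hfinS : ((latClosureSublattice S : Sublattice (∀ n, M n)) : Set (∀ n, M n)).Finite :=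
    hlf ⟨∀ n, M n, inferInstance⟩ hprod S
      (((Set.finite_range P).union (Set.finite_range Q)).union (Set.finite_singleton _))
  have hsub : ∀ y ∈ S, y ∈ latClosureSublattice S :=
    subset_latClosure ⟨∀ n, M n, inferInstance⟩ S
  have hmem : ∀ j, Y j ∈ latClosureSublattice S := by
    intro j
    induction j with
    | zero => exact hsub _ (Or.inr rfl)
    | succ j ih =>
      exact Sublattice.sup_mem ih (Sublattice.inf_mem (Sublattice.sup_mem ih
        (hsub _ (Or.inl (Or.inl ⟨_, rfl⟩))))
        (hsub _ (Or.inl (Or.inr ⟨_, rfl⟩))))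
  exact Set.infinite_of_injective_forall_mem hYinj hmem hfinS
end

section
/- (Graham–Rothschild) Let A be a finite alphabet and let m, ℓ ≥ 1 and k ≥ 2 be integers. Then there exists an n such that for every partition W^n_ℓ(A) = X_1 ∪ … ∪ X_k there exist u ∈ W^n_m(A) and j ∈ {1, …, k} such that {u · v : v ∈ W^m_ℓ(A)} ⊆ X_j. -/
/-- `w : Fin n → α ⊕ Fin m` is an `m`-parameter word over the alphabet `α` of
length `n`: every parameter `x_i` occurs, and the first occurrence of `x_i`
precedes the first occurrence of `x_j` whenever `i < j`. -/
def IsPW (α : Type) (n m : ℕ) (w : Fin n → α ⊕ Fin m) : Prop :=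
  (∀ i : Fin m, ∃ p : Fin n, w p = Sum.inr i) ∧
  (∀ i j : Fin m, i < j →
    sInf {p : ℕ | ∃ h : p < n, w ⟨p, h⟩ = Sum.inr i} <
      sInf {p : ℕ | ∃ h : p < n, w ⟨p, h⟩ = Sum.inr j})

/-- The composition `u · v` of parameter words: substitute `v i` for each
occurrence of the parameter `x_i` in `u`. -/
def compPW {α : Type} {n m k : ℕ} (u : Fin n → α ⊕ Fin m)
    (v : Fin m → α ⊕ Fin k) : Fin n → α ⊕ Fin k :=
  fun p => Sum.elim Sum.inl v (u p)

namespace GrahamRothschild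

variable {α : Type}

/-- `ParamList k j w` says that `w` lists the letters of a word in which the parameters below `j`
count as letters of the alphabet, and the remaining parameters `j, …, k - 1` all occur, with first
occurrences in increasing order. -/
def ParamList (k : ℕ) : ℕ → List (α ⊕ ℕ) → Prop
  | j, [] => j = k
  | j, Sum.inl _ :: w => ParamList k j w
  | j, Sum.inr i :: w => (i < j ∧ ParamList k j w) ∨ (i = j ∧ ParamList k (j + 1) w)

/-- Whether a symbol is a letter of the alphabet extended by the parameters below `j`. -/
def isLetter (j : ℕ) : α ⊕ ℕ → Bool :=
  Sum.elim (fun _ => true) (fun i => decide (i < j))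

/-- Substitute the entries of `v` for the parameters `j, j + 1, …`. -/
def subst (j : ℕ) (v : List (α ⊕ ℕ)) : α ⊕ ℕ → α ⊕ ℕ
  | Sum.inl a => Sum.inl a
  | Sum.inr i => if i < j then Sum.inr i else v.getD (i - j) (Sum.inr 0)

/-- Increase by one the index of every parameter that is at least `d`. -/
def shift (d : ℕ) : α ⊕ ℕ → α ⊕ ℕ
  | Sum.inl a => Sum.inl a
  | Sum.inr i => if i < d then Sum.inr i else Sum.inr (i + 1)

/-- The part of a word before the first occurrence of a parameter with index at least `j`. -/
def letterPrefix (j : ℕ) (w : List (α ⊕ ℕ)) : List (α ⊕ ℕ) :=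
  w.takeWhile (isLetter j)

@[simp] lemma isLetter_inl (j : ℕ) (a : α) : isLetter j (Sum.inl a : α ⊕ ℕ) = true := rfl

@[simp] lemma isLetter_inr (j i : ℕ) :
    isLetter j (Sum.inr i : α ⊕ ℕ) = decide (i < j) := rfl

lemma ParamList.start_le {k j : ℕ} {w : List (α ⊕ ℕ)} (h : ParamList k j w) : j ≤ k := by
  induction w generalizing j with
  | nil => exact Nat.le_of_eq h
  | cons x w ih =>
    rcases x with a | i
    · exact ih h
    · rcases h with ⟨-, h⟩ | ⟨-, h⟩
      · exact ih h
      · exact (Nat.le_succ j).trans (ih h)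

lemma ParamList.forall_isLetter {k j : ℕ} {w : List (α ⊕ ℕ)} (h : ParamList k j w) :
    ∀ x ∈ w, isLetter k x = true := by
  induction w generalizing j with
  | nil => simp
  | cons x w ih =>
    rcases x with a | i
    · simpa using ih h
    · rcases h with ⟨hi, h⟩ | ⟨hi, h⟩
      · have := h.start_le
        simpa [show i < k by omega] using ih h
      · have := h.start_le
        simpa [show i < k by omega] using ih h

lemma paramList_cons_of_isLetter {k j : ℕ} {x : α ⊕ ℕ} {w : List (α ⊕ ℕ)}
    (hx : isLetter j x = true) : ParamList k j (x :: w) ↔ ParamList k j w := by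
  rcases x with a | i
  · exact Iff.rfl
  · have hi : i < j := by simpa using hx
    simp [ParamList, hi, hi.ne]

lemma paramList_cons_of_not_isLetter {k j : ℕ} {x : α ⊕ ℕ} {w : List (α ⊕ ℕ)}
    (hx : isLetter j x = false) :
    ParamList k j (x :: w) ↔ x = Sum.inr j ∧ ParamList k (j + 1) w := by
  rcases x with a | i
  · simp at hx
  · have hi : ¬ i < j := by simpa using hx
    simp [ParamList, hi]

lemma ParamList.append {k l j : ℕ} {v w : List (α ⊕ ℕ)} (hv : ParamList k j v)
    (hw : ParamList l k w) : ParamList l j (v ++ w) := by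
  induction v generalizing j with
  | nil => rw [show j = k from hv]; exact hw
  | cons x v ih =>
    rcases x with a | i
    · exact ih hv
    · rcases hv with ⟨hi, h⟩ | ⟨hi, h⟩
      · exact Or.inl ⟨hi, ih h⟩
      · exact Or.inr ⟨hi, ih h⟩

lemma paramList_of_forall_isLetter {j : ℕ} {w : List (α ⊕ ℕ)}
    (h : ∀ x ∈ w, isLetter j x = true) : ParamList j j w := by
  induction w with
  | nil => rfl
  | cons x w ih =>
    rw [paramList_cons_of_isLetter (h x (by simp))]
    exact ih fun y hy => h y (by simp [hy])

lemma paramList_succ {j : ℕ} {w : List (α ⊕ ℕ)} (h : ∀ x ∈ w, isLetter (j + 1) x = true)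
    (hj : Sum.inr j ∈ w) : ParamList (j + 1) j w := by
  induction w with
  | nil => simp at hj
  | cons x w ih =>
    have hw : ∀ y ∈ w, isLetter (j + 1) y = true := fun y hy => h y (by simp [hy])
    by_cases hx : isLetter j x = true
    · rw [paramList_cons_of_isLetter hx]
      refine ih hw ((List.mem_cons.1 hj).resolve_left ?_)
      rintro rfl
      simp at hx
    · rw [paramList_cons_of_not_isLetter (by simpa using hx)]
      refine ⟨?_, paramList_of_forall_isLetter hw⟩
      have hx' := h x (by simp)
      rcases x with a | i
      · simp at hx
      · simp at hx hx'
        rw [show i = j by omega]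

lemma ParamList.map_shift {k j d : ℕ} {w : List (α ⊕ ℕ)} (hd : d ≤ j) (h : ParamList k j w) :
    ParamList (k + 1) (j + 1) (w.map (shift d)) := by
  induction w generalizing j with
  | nil => exact congrArg (· + 1) h
  | cons x w ih =>
    rcases x with a | i
    · exact ih hd h
    · rcases h with ⟨hi, h⟩ | ⟨hi, h⟩
      · rw [List.map_cons, paramList_cons_of_isLetter]
        · exact ih hd h
        · simp only [shift]
          split_ifs <;> simp <;> omega
      · have : ¬ i < d := by omega
        simp only [List.map_cons, shift, this, if_false]
        exact Or.inr ⟨by omega, ih (by omega) h⟩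

lemma subst_of_isLetter {j : ℕ} {x : α ⊕ ℕ} (hx : isLetter j x = true) (v : List (α ⊕ ℕ)) :
    subst j v x = x := by
  rcases x with a | i
  · rfl
  · simp at hx
    simp [subst, hx]

@[simp] lemma subst_cons_self (j : ℕ) (x : α ⊕ ℕ) (v : List (α ⊕ ℕ)) :
    subst j (x :: v) (Sum.inr j) = x := by
  simp [subst]

lemma subst_cons_inr (j : ℕ) (v : List (α ⊕ ℕ)) :
    subst j (Sum.inr j :: v) = subst (j + 1) v := by
  funext x
  rcases x with a | i
  · rfl
  · rcases lt_trichotomy i j with h | rfl | h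
    · simp [subst, h, h.trans (Nat.lt_succ_self j)]
    · simp [subst]
    · obtain ⟨e, rfl⟩ := Nat.exists_eq_add_of_lt h
      simp [subst, show ¬ j + e + 1 < j by omega, show ¬ j + e + 1 < j + 1 by omega,
        show j + e + 1 - j = e + 1 by omega, show j + e + 1 - (j + 1) = e by omega]

lemma subst_cons_shift (j : ℕ) (a : α ⊕ ℕ) (v : List (α ⊕ ℕ)) (x : α ⊕ ℕ) :
    subst j (a :: v) (shift j x) = subst j v x := by
  rcases x with b | i
  · rfl
  · by_cases h : i < j
    · simp [subst, shift, h]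
    · simp [subst, shift, h, show ¬ i + 1 < j by omega, show i + 1 - j = (i - j) + 1 by omega]

lemma map_shift_subst_cons (j : ℕ) (a : α ⊕ ℕ) (v u : List (α ⊕ ℕ)) :
    (u.map (shift j)).map (subst j (a :: v)) = u.map (subst j v) := by
  rw [List.map_map]
  exact List.map_congr_left fun x _ => subst_cons_shift j a v x

lemma subst_subst {j : ℕ} {v w : List (α ⊕ ℕ)} {x : α ⊕ ℕ}
    (hx : isLetter (j + v.length) x = true) :
    subst j w (subst j v x) = subst j (v.map (subst j w)) x := by
  rcases x with a | i
  · rfl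
  · by_cases h : i < j
    · simp [subst, h]
    · have h' : i - j < v.length := by
        simp at hx
        omega
      simp [subst, h, h']

lemma map_subst_subst {j : ℕ} {u v w : List (α ⊕ ℕ)} (hu : ParamList (j + v.length) j u) :
    (u.map (subst j v)).map (subst j w) = u.map (subst j (v.map (subst j w))) := by
  rw [List.map_map]
  exact List.map_congr_left fun x hx => subst_subst (hu.forall_isLetter x hx)

lemma subst_cons_subst_succ {j : ℕ} {v : List (α ⊕ ℕ)} {a : α ⊕ ℕ} {u : List (α ⊕ ℕ)}
    {x : α ⊕ ℕ} (hx : isLetter (j + 1 + u.length) x = true) :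
    subst j (a :: v) (subst (j + 1) (u.map (shift j)) x) =
      subst j (a :: u.map (subst j v)) x := by
  rw [← subst_cons_inr, subst_subst (by
    rwa [List.length_cons, List.length_map, ← add_assoc, add_right_comm])]
  simp only [List.map_cons, subst_cons_self]
  rw [map_shift_subst_cons]

lemma ParamList.map_subst {j s t : ℕ} (hjs : j ≤ s) {u v₁ v₂ : List (α ⊕ ℕ)}
    (hu : ParamList (j + (v₁ ++ v₂).length) (j + v₁.length) u)
    (hv₁ : ∀ x ∈ v₁, isLetter s x = true) (hv₂ : ParamList t s v₂) :
    ParamList t s (u.map (subst j (v₁ ++ v₂))) := by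
  induction u generalizing s v₁ v₂ with
  | nil =>
    have : v₂ = [] := by
      have h : j + v₁.length = j + (v₁ ++ v₂).length := hu
      rw [List.length_append] at h
      exact List.length_eq_zero_iff.1 (by omega)
    subst this
    exact hv₂
  | cons x u ih =>
    rw [List.map_cons]
    by_cases hx : isLetter (j + v₁.length) x = true
    · rw [paramList_cons_of_isLetter hx] at hu
      rw [paramList_cons_of_isLetter]
      · exact ih hjs hu hv₁ hv₂
      · rcases x with a | i
        · rfl
        · by_cases h : i < j
          · simp [subst, h]
            omega
          · have h' : i - j < v₁.length := by
              simp at hx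
              omega
            simp only [subst, h, if_false, List.getD_eq_getElem?_getD,
              List.getElem?_append_left h', List.getElem?_eq_getElem h', Option.getD_some]
            exact hv₁ _ (List.getElem_mem h')
    · rw [paramList_cons_of_not_isLetter (by simpa using hx)] at hu
      obtain ⟨rfl, hu⟩ := hu
      have hle := hu.start_le
      rcases v₂ with _ | ⟨y, v₂⟩
      · simp at hle
      · have e : subst j (v₁ ++ y :: v₂) (Sum.inr (j + v₁.length)) = y := by
          simp [subst]
        have e' : v₁ ++ y :: v₂ = (v₁ ++ [y]) ++ v₂ := by simp
        have hu' : ParamList (j + ((v₁ ++ [y]) ++ v₂).length) (j + (v₁ ++ [y]).length) u := by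
          simpa [add_assoc] using hu
        rw [e]
        by_cases hy : isLetter s y = true
        · rw [paramList_cons_of_isLetter hy] at hv₂ ⊢
          rw [e']
          refine ih hjs hu' ?_ hv₂
          intro z hz
          rcases List.mem_append.1 hz with hz | hz
          · exact hv₁ z hz
          · rw [List.mem_singleton.1 hz]; exact hy
        · rw [paramList_cons_of_not_isLetter (by simpa using hy)] at hv₂ ⊢
          refine ⟨hv₂.1, ?_⟩
          rw [e']
          refine ih (hjs.trans (Nat.le_succ s)) hu' ?_ hv₂.2
          intro z hz
          rcases List.mem_append.1 hz with hz | hz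
          · have := hv₁ z hz
            rcases z with a | i
            · rfl
            · simp at this ⊢
              omega
          · rw [List.mem_singleton.1 hz, hv₂.1]; simp

lemma ParamList.comp {j m t : ℕ} {u v : List (α ⊕ ℕ)} (hu : ParamList (j + m) j u)
    (hv : v.length = m) (hv' : ParamList t j v) : ParamList t j (u.map (subst j v)) := by
  subst hv
  exact ParamList.map_subst (v₁ := []) le_rfl hu (by simp) hv'

lemma letterPrefix_cons_of_isLetter {j : ℕ} {x : α ⊕ ℕ} (hx : isLetter j x = true)
    (w : List (α ⊕ ℕ)) : letterPrefix j (x :: w) = x :: letterPrefix j w := by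
  simp [letterPrefix, hx]

lemma letterPrefix_cons_of_not_isLetter {j : ℕ} {x : α ⊕ ℕ} (hx : isLetter j x = false)
    (w : List (α ⊕ ℕ)) : letterPrefix j (x :: w) = [] := by
  simp [letterPrefix, hx]

lemma letterPrefix_append {j : ℕ} {p : List (α ⊕ ℕ)} (hp : ∀ x ∈ p, isLetter j x = true)
    (w : List (α ⊕ ℕ)) : letterPrefix j (p ++ w) = p ++ letterPrefix j w :=
  List.takeWhile_append_of_pos hp

lemma letterPrefix_of_forall_isLetter {j : ℕ} {w : List (α ⊕ ℕ)}
    (hw : ∀ x ∈ w, isLetter j x = true) : letterPrefix j w = w :=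
  List.takeWhile_eq_self_iff.2 hw

lemma isLetter_of_mem_letterPrefix {j : ℕ} {w : List (α ⊕ ℕ)} {x : α ⊕ ℕ}
    (hx : x ∈ letterPrefix j w) : isLetter j x = true :=
  List.mem_takeWhile_imp hx

lemma length_letterPrefix_le (j : ℕ) (w : List (α ⊕ ℕ)) :
    (letterPrefix j w).length ≤ w.length :=
  (List.takeWhile_prefix _).length_le

lemma letterPrefix_map_subst_append {j : ℕ} {b : List (α ⊕ ℕ)} {k : ℕ} (hb : ParamList k j b)
    (hk : j < k) {y : α ⊕ ℕ} (hy : isLetter j y = false) (v w : List (α ⊕ ℕ)) :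
    letterPrefix j (b.map (subst j (y :: v)) ++ w) = letterPrefix j b := by
  induction b with
  | nil => exact absurd hb hk.ne
  | cons x b ih =>
    by_cases hx : isLetter j x = true
    · rw [paramList_cons_of_isLetter hx] at hb
      rw [List.map_cons, List.cons_append, subst_of_isLetter hx, letterPrefix_cons_of_isLetter hx,
        letterPrefix_cons_of_isLetter hx, ih hb]
    · rw [letterPrefix_cons_of_not_isLetter (by simpa using hx)]
      rw [paramList_cons_of_not_isLetter (by simpa using hx)] at hb
      rw [hb.1, List.map_cons, List.cons_append, subst_cons_self,
        letterPrefix_cons_of_not_isLetter hy]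

instance finite_letters [Finite α] (j : ℕ) : Finite {x : α ⊕ ℕ // isLetter j x = true} := by
  refine Finite.of_surjective
    (fun x : α ⊕ Fin j => (⟨Sum.map id Fin.val x, by rcases x with a | i <;> simp⟩ :
      {x : α ⊕ ℕ // isLetter j x = true})) ?_
  rintro ⟨a | i, hx⟩
  · exact ⟨Sum.inl a, rfl⟩
  · exact ⟨Sum.inr ⟨i, by simpa using hx⟩, rfl⟩

/-- The Hales–Jewett theorem for lists. -/
lemma exists_line [Finite α] (j : ℕ) (κ : Type) [Finite κ] :
    ∃ n, ∀ χ : List (α ⊕ ℕ) → κ, ∃ b : List (α ⊕ ℕ), b.length = n ∧ ParamList (j + 1) j b ∧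
      ∃ c, ∀ x v, isLetter j x = true → χ (b.map (subst j (x :: v))) = c := by
  obtain ⟨n, hn⟩ := Combinatorics.Subspace.exists_mono_in_high_dimension_fin
    {x : α ⊕ ℕ // isLetter j x = true} κ Unit
  refine ⟨n, fun χ => ?_⟩
  obtain ⟨l, c, hc⟩ := hn fun f => χ (List.ofFn fun p => (f p : α ⊕ ℕ))
  refine ⟨List.ofFn fun p => Sum.elim Subtype.val (fun _ => Sum.inr j) (l.idxFun p),
    List.length_ofFn, ?_, c, fun x v hx => ?_⟩
  · refine paramList_succ ?_ ?_
    · intro x hx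
      obtain ⟨p, rfl⟩ := (List.mem_ofFn' _ _).1 hx
      beta_reduce
      rcases l.idxFun p with ⟨a | i, ha⟩ | -
      · rfl
      · have hi : i < j := by simpa using ha
        simpa using hi.le
      · simp
    · obtain ⟨p, hp⟩ := l.proper ()
      exact (List.mem_ofFn' _ _).2 ⟨p, by simp [hp]⟩
  · rw [← hc fun _ => ⟨x, hx⟩, List.map_ofFn]
    congr 2
    funext p
    rw [Combinatorics.Subspace.apply_def, Function.comp_apply]
    rcases l.idxFun p with a | -
    · exact subst_of_isLetter a.2 _
    · exact subst_cons_self _ _ _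

lemma map_subst_isLetter {j : ℕ} {b : List (α ⊕ ℕ)} (hb : ∀ y ∈ b, isLetter (j + 1) y = true)
    {x : α ⊕ ℕ} (hx : isLetter j x = true) (v : List (α ⊕ ℕ)) :
    ∀ y ∈ b.map (subst j (x :: v)), isLetter j y = true := by
  intro y hy
  obtain ⟨z, hz, rfl⟩ := List.mem_map.1 hy
  by_cases h : isLetter j z = true
  · rwa [subst_of_isLetter h]
  · have hz' := hb z hz
    rcases z with a | i
    · simp at h
    · simp at h hz'
      rw [show i = j by omega, subst_cons_self, hx]

/-- The colour of the letter prefix can be made to depend on its length before substitution. -/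
lemma exists_color_prefix_eq_length [Finite α] (j m : ℕ) (κ : Type) [Finite κ] :
    ∃ n, ∀ χ : List (α ⊕ ℕ) → κ, ∃ u : List (α ⊕ ℕ), u.length = n ∧ ParamList (j + m) j u ∧
      ∃ d : ℕ → κ, ∀ v : List (α ⊕ ℕ), v.length = m →
        χ (letterPrefix j (u.map (subst j v))) = d (letterPrefix j v).length := by
  induction m with
  | zero =>
    refine ⟨0, fun χ => ⟨[], rfl, rfl, fun _ => χ [], fun v _ => rfl⟩⟩
  | succ m ih =>
    obtain ⟨n, hn⟩ := ih
    have : Finite {s : List {x : α ⊕ ℕ // isLetter j x = true} // s.length ≤ n} :=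
      (List.finite_length_le _ n).to_subtype
    obtain ⟨N, hN⟩ := exists_line (α := α) j
      ({s : List {x : α ⊕ ℕ // isLetter j x = true} // s.length ≤ n} → κ)
    refine ⟨N + n, fun χ => ?_⟩
    obtain ⟨b, hbN, hb, c, hc⟩ := hN fun q s => χ (q ++ s.1.map Subtype.val)
    classical
    obtain ⟨u, hun, hu, d, hd⟩ := hn fun s =>
      if hs : ∃ s' : {s : List {x : α ⊕ ℕ // isLetter j x = true} // s.length ≤ n},
        s'.1.map Subtype.val = s then c hs.choose else χ []
    refine ⟨b ++ u.map (shift j), by simp [hbN, hun], hb.append ?_,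
      fun i => i.casesOn (χ (letterPrefix j b)) d, fun v hv => ?_⟩
    · have := hu.map_shift le_rfl
      rwa [add_assoc] at this
    · rcases v with _ | ⟨x, v⟩
      · simp at hv
      rw [List.map_append, map_shift_subst_cons]
      by_cases hx : isLetter j x = true
      · rw [letterPrefix_append (map_subst_isLetter hb.forall_isLetter hx v),
          letterPrefix_cons_of_isLetter hx]
        have hs : ∃ s' : {s : List {x : α ⊕ ℕ // isLetter j x = true} // s.length ≤ n},
            s'.1.map Subtype.val = letterPrefix j (u.map (subst j v)) := by
          refine ⟨⟨(letterPrefix j (u.map (subst j v))).attach.map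
            fun x => ⟨x.1, isLetter_of_mem_letterPrefix x.2⟩, ?_⟩, ?_⟩
          · simpa [hun] using length_letterPrefix_le j (u.map (subst j v))
          · rw [List.map_map]
            exact List.attach_map_subtype_val _
        have := hd v (by simpa using hv)
        rw [dif_pos hs] at this
        rw [List.length_cons]
        refine Eq.trans ?_ this
        conv_lhs => rw [← hs.choose_spec]
        exact congrFun (hc x v hx) _
      · have hx : isLetter j x = false := by simpa using hx
        rw [letterPrefix_map_subst_append hb (Nat.lt_succ_self j) hx,
          letterPrefix_cons_of_not_isLetter hx]
        rfl

/-- A word whose parameters first occur only at positions in `S`. -/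
lemma exists_length_letterPrefix_mem {j : ℕ} {a : α ⊕ ℕ} (ha : isLetter j a = true) (n m : ℕ)
    (S : ℕ → Prop) [DecidablePred S] (hm : m ≤ n.count S) :
    ∃ u : List (α ⊕ ℕ), u.length = n ∧ ParamList (j + m) j u ∧
      ∀ v : List (α ⊕ ℕ), v.length = m → (∃ x ∈ v, isLetter j x = false) →
        S (letterPrefix j (u.map (subst j v))).length := by
  induction n generalizing m S with
  | zero =>
    obtain rfl : m = 0 := by simpa using hm
    refine ⟨[], rfl, rfl, fun v hv h => ?_⟩
    simp [List.length_eq_zero_iff.1 hv] at h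
  | succ n ih =>
    rw [Nat.count_succ'] at hm
    by_cases hS : S 0 ∧ m ≠ 0
    · obtain ⟨m, rfl⟩ := Nat.exists_eq_succ_of_ne_zero hS.2
      rw [if_pos hS.1] at hm
      obtain ⟨u, hun, hu, h⟩ := ih m (fun i => S (i + 1)) (by omega)
      refine ⟨Sum.inr j :: u.map (shift j), by simp [hun], Or.inr ⟨rfl, ?_⟩, ?_⟩
      · have := hu.map_shift le_rfl
        rwa [add_assoc] at this
      · rintro (_ | ⟨x, v⟩) hv hx
        · simp at hv
        rw [List.map_cons, subst_cons_self, map_shift_subst_cons]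
        by_cases hx' : isLetter j x = true
        · rw [letterPrefix_cons_of_isLetter hx']
          refine h v (by simpa using hv) ?_
          simpa [hx'] using hx
        · rw [letterPrefix_cons_of_not_isLetter (by simpa using hx')]
          exact hS.1
    · obtain ⟨u, hun, hu, h⟩ := ih m (fun i => S (i + 1)) (by split_ifs at hm <;> grind)
      refine ⟨a :: u, by simp [hun], (paramList_cons_of_isLetter ha).2 hu, fun v hv hx => ?_⟩
      rw [List.map_cons, subst_of_isLetter ha, letterPrefix_cons_of_isLetter ha]
      exact h v hv hx

lemma exists_length_letterPrefix_mono (α : Type) (j m : ℕ) (κ : Type) [Finite κ] :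
    ∃ n, ∀ d : ℕ → κ, ∃ u : List (α ⊕ ℕ), u.length = n ∧ ParamList (j + m) j u ∧
      ∃ c, ∀ v : List (α ⊕ ℕ), v.length = m → (∃ x ∈ v, isLetter j x = false) →
        d (letterPrefix j (u.map (subst j v))).length = c := by
  classical
  cases nonempty_fintype κ
  by_cases h : ∃ a : α ⊕ ℕ, isLetter j a = true
  · obtain ⟨a, ha⟩ := h
    refine ⟨Fintype.card κ * m, fun d => ?_⟩
    rcases Nat.eq_zero_or_pos m with rfl | hm
    · refine ⟨[], by simp, rfl, d 0, fun v hv h => ?_⟩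
      simp [List.length_eq_zero_iff.1 hv] at h
    have : Nonempty κ := ⟨d 0⟩
    obtain ⟨c, -, hc⟩ := Finset.exists_le_card_fiber_of_mul_le_card_of_maps_to
      (s := Finset.range (Fintype.card κ * m)) (t := Finset.univ) (f := d) (n := m)
      (fun _ _ => Finset.mem_univ _) Finset.univ_nonempty (by simp)
    obtain ⟨u, hun, hu, h⟩ := exists_length_letterPrefix_mem ha (Fintype.card κ * m) m
      (fun i => d i = c) (by rwa [Nat.count_eq_card_filter_range])
    exact ⟨u, hun, hu, c, h⟩
  · have hnil : ∀ w : List (α ⊕ ℕ), letterPrefix j w = [] := by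
      rintro (_ | ⟨x, w⟩)
      · rfl
      · exact letterPrefix_cons_of_not_isLetter (by simpa using fun hx => h ⟨x, hx⟩) w
    have hex : ∃ u : List (α ⊕ ℕ), ParamList (j + m) j u := by
      clear h hnil
      induction m generalizing j with
      | zero => exact ⟨[], rfl⟩
      | succ m ih =>
        obtain ⟨u, hu⟩ := ih (j + 1)
        exact ⟨Sum.inr j :: u, Or.inr ⟨rfl, by rwa [add_right_comm, add_assoc] at hu⟩⟩
    obtain ⟨u, hu⟩ := hex
    exact ⟨u.length, fun d => ⟨u, rfl, hu, d 0, fun v _ _ => by rw [hnil]; rfl⟩⟩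

/-- Words over `α` with `ℓ` parameters beyond the first `j`, which count as letters, satisfy the
Graham–Rothschild theorem. -/
def GrahamRothschildAt (α : Type) (ℓ j : ℕ) : Prop :=
  ∀ (m : ℕ) (κ : Type) [Finite κ], ∃ n, ∀ χ : List (α ⊕ ℕ) → κ, ∃ u : List (α ⊕ ℕ),
    u.length = n ∧ ParamList (j + m) j u ∧
      ∃ c, ∀ v : List (α ⊕ ℕ), v.length = m → ParamList (j + ℓ) j v → χ (u.map (subst j v)) = c

lemma grahamRothschildAt_zero [Finite α] (j : ℕ) : GrahamRothschildAt α 0 j := by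
  intro m κ _
  obtain ⟨n, hn⟩ := exists_color_prefix_eq_length (α := α) j m κ
  refine ⟨n, fun χ => ?_⟩
  obtain ⟨u, hun, hu, d, hd⟩ := hn χ
  refine ⟨u, hun, hu, d m, fun v hv hv' => ?_⟩
  have := hd v hv
  rw [add_zero] at hv'
  rwa [letterPrefix_of_forall_isLetter (hu.comp hv hv').forall_isLetter,
    letterPrefix_of_forall_isLetter hv'.forall_isLetter, hv] at this

/-- The colour of a word can be made to depend only on the letter prefix before substitution. -/
lemma exists_color_eq_color_prefix [Finite α] {ℓ j : ℕ} (h : GrahamRothschildAt α ℓ (j + 1))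
    (m : ℕ) (κ : Type) [Finite κ] :
    ∃ n, ∀ χ : List (α ⊕ ℕ) → κ, ∃ u : List (α ⊕ ℕ), u.length = n ∧ ParamList (j + m) j u ∧
      ∃ d : List (α ⊕ ℕ) → κ, ∀ v : List (α ⊕ ℕ), v.length = m → ParamList (j + ℓ + 1) j v →
        χ (u.map (subst j v)) = d (letterPrefix j v) := by
  induction m generalizing κ with
  | zero =>
    refine ⟨0, fun χ => ⟨[], rfl, rfl, fun _ => χ [], fun v _ _ => rfl⟩⟩
  | succ m ih =>
    obtain ⟨M, hM⟩ := ih ({x : α ⊕ ℕ // isLetter j x = true} → κ)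
    obtain ⟨n, hn⟩ := h M κ
    refine ⟨n + 1, fun χ => ?_⟩
    obtain ⟨t, htn, ht, c, hc⟩ := hn fun r => χ (Sum.inr j :: r)
    obtain ⟨u, huM, hu, d, hd⟩ := hM fun w a => χ (a.1 :: t.map (subst j (a.1 :: w)))
    have hassoc : ∀ x v, (t.map (subst (j + 1) (u.map (shift j)))).map (subst j (x :: v)) =
        t.map (subst j (x :: u.map (subst j v))) := by
      intro x v
      rw [List.map_map]
      exact List.map_congr_left fun y hy =>
        subst_cons_subst_succ (by rw [huM]; exact ht.forall_isLetter y hy)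
    classical
    refine ⟨Sum.inr j :: t.map (subst (j + 1) (u.map (shift j))), by simp [htn],
      Or.inr ⟨rfl, ?_⟩, fun p => p.casesOn c fun x p =>
        if hx : isLetter j x = true then d p ⟨x, hx⟩ else c, ?_⟩
    · refine ht.comp (by simpa using huM) ?_
      have := hu.map_shift le_rfl
      rwa [add_assoc] at this
    · rintro (_ | ⟨x, v⟩) hv hv'
      · simp at hv
      have hvm : v.length = m := by simpa using hv
      rw [List.map_cons, subst_cons_self, hassoc]
      by_cases hx : isLetter j x = true
      · rw [paramList_cons_of_isLetter hx] at hv'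
        rw [letterPrefix_cons_of_isLetter hx]
        simp only [dif_pos hx]
        exact congrFun (hd v hvm hv') ⟨x, hx⟩
      · rw [letterPrefix_cons_of_not_isLetter (by simpa using hx)]
        rw [paramList_cons_of_not_isLetter (by simpa using hx)] at hv'
        obtain ⟨rfl, hv'⟩ := hv'
        rw [subst_cons_inr]
        refine hc _ (by simpa using huM) ?_
        subst hvm
        rw [add_right_comm]
        exact ParamList.map_subst (v₁ := []) (Nat.le_succ j) hu (by simp) hv'

lemma ParamList.exists_not_isLetter {k j : ℕ} {w : List (α ⊕ ℕ)} (h : ParamList k j w)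
    (hk : j < k) : ∃ x ∈ w, isLetter j x = false := by
  by_contra! hw
  induction w with
  | nil => exact hk.ne h
  | cons x w ih =>
    rw [paramList_cons_of_isLetter (by simpa using hw x (by simp))] at h
    exact ih h fun y hy => hw y (by simp [hy])

lemma grahamRothschildAt [Finite α] (ℓ j : ℕ) : GrahamRothschildAt α ℓ j := by
  induction ℓ generalizing j with
  | zero => exact grahamRothschildAt_zero j
  | succ ℓ ih =>
    intro m κ _
    obtain ⟨n₁, h₁⟩ := exists_length_letterPrefix_mono α j m κ
    obtain ⟨n₂, h₂⟩ := exists_color_prefix_eq_length (α := α) j n₁ κ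
    obtain ⟨n₃, h₃⟩ := exists_color_eq_color_prefix (ih (j + 1)) n₂ κ
    refine ⟨n₃, fun χ => ?_⟩
    obtain ⟨u₃, hun₃, hu₃, d₃, hd₃⟩ := h₃ χ
    obtain ⟨u₂, hun₂, hu₂, d₂, hd₂⟩ := h₂ d₃
    obtain ⟨u₁, hun₁, hu₁, c, hc⟩ := h₁ d₂
    refine ⟨u₃.map (subst j (u₂.map (subst j u₁))), by simpa using hun₃,
      hu₃.comp (by simpa using hun₂) (hu₂.comp hun₁ hu₁), c, fun v hv hv' => ?_⟩
    rw [map_subst_subst (by simpa [hun₂] using hu₃), map_subst_subst (by simpa [hun₁] using hu₂),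
      hd₃ _ (by simpa using hun₂) (hu₂.comp (by simpa using hun₁) (hu₁.comp hv hv')),
      hd₂ _ (by simpa using hun₁)]
    exact hc v hv (hv'.exists_not_isLetter (by omega))

lemma paramList_iff {k j : ℕ} {w : List (α ⊕ ℕ)} :
    ParamList k j w ↔ j ≤ k ∧ (∀ i, j ≤ i → i < k → ∃ p : ℕ, w[p]? = some (Sum.inr i)) ∧
      ∀ (p i : ℕ), w[p]? = some (Sum.inr i) → i < k ∧
        ∀ i', j ≤ i' → i' < i → ∃ p' < p, w[p']? = some (Sum.inr i') := by
  induction w generalizing j with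
  | nil =>
    simp only [ParamList, List.getElem?_nil, reduceCtorEq, exists_false, false_imp_iff,
      implies_true, and_true]
    refine ⟨fun h => ⟨h.le, fun i h₁ h₂ => by omega⟩, fun ⟨h₁, h₂⟩ => ?_⟩
    by_contra h
    exact h₂ j le_rfl (by omega)
  | cons x w ih =>
    by_cases hx : isLetter j x = true
    · have hne : ∀ i, j ≤ i → x ≠ Sum.inr i := by
        rintro i hi rfl
        simp at hx
        omega
      rw [paramList_cons_of_isLetter hx, ih]
      refine and_congr_right fun hjk => and_congr ?_ ?_
      · refine forall_congr' fun i => imp_congr_right fun hi => imp_congr_right fun _ => ?_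
        refine ⟨fun ⟨p, hp⟩ => ⟨p + 1, by simpa using hp⟩, ?_⟩
        rintro ⟨_ | p, hp⟩
        · exact absurd (by simpa using hp) (hne i hi)
        · exact ⟨p, by simpa using hp⟩
      · constructor
        · rintro h (_ | p) i hp
          · obtain rfl : x = Sum.inr i := by simpa using hp
            simp at hx
            exact ⟨by omega, fun i' _ _ => by omega⟩
          · obtain ⟨h₁, h₂⟩ := h p i (by simpa using hp)
            refine ⟨h₁, fun i' hi' hlt => ?_⟩
            obtain ⟨p', hp', h'⟩ := h₂ i' hi' hlt
            exact ⟨p' + 1, by omega, by simpa using h'⟩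
        · intro h p i hp
          obtain ⟨h₁, h₂⟩ := h (p + 1) i (by simpa using hp)
          refine ⟨h₁, fun i' hi' hlt => ?_⟩
          obtain ⟨_ | p', hp', h'⟩ := h₂ i' hi' hlt
          · exact absurd (by simpa using h') (hne i' hi')
          · exact ⟨p', by omega, by simpa using h'⟩
    · rw [paramList_cons_of_not_isLetter (by simpa using hx), ih]
      constructor
      · rintro ⟨rfl, hjk, h₁, h₂⟩
        refine ⟨by omega, fun i hi hik => ?_, ?_⟩
        · rcases hi.eq_or_lt with rfl | hi
          · exact ⟨0, rfl⟩
          · obtain ⟨p, hp⟩ := h₁ i hi hik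
            exact ⟨p + 1, by simpa using hp⟩
        · rintro (_ | p) i hp
          · obtain rfl : j = i := by simpa using hp
            exact ⟨by omega, fun i' _ _ => by omega⟩
          · obtain ⟨h₃, h₄⟩ := h₂ p i (by simpa using hp)
            refine ⟨h₃, fun i' hi' hlt => ?_⟩
            rcases hi'.eq_or_lt with rfl | hi'
            · exact ⟨0, by omega, rfl⟩
            · obtain ⟨p', hp', h'⟩ := h₄ i' hi' hlt
              exact ⟨p' + 1, by omega, by simpa using h'⟩
      · rintro ⟨hjk, h₁, h₂⟩
        obtain rfl : x = Sum.inr j := by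
          rcases x with a | i
          · simp at hx
          · have hi : j ≤ i := by simpa using hx
            rcases hi.eq_or_lt with rfl | hi
            · rfl
            · obtain ⟨p, hp, -⟩ := (h₂ 0 i rfl).2 j le_rfl hi
              omega
        refine ⟨rfl, (h₂ 0 j rfl).1, fun i hi hik => ?_, fun p i hp => ?_⟩
        · obtain ⟨_ | p, hp⟩ := h₁ i (by omega) hik
          · have : j = i := by simpa using hp
            omega
          · exact ⟨p, by simpa using hp⟩
        · obtain ⟨h₃, h₄⟩ := h₂ (p + 1) i (by simpa using hp)
          refine ⟨h₃, fun i' hi' hlt => ?_⟩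
          obtain ⟨_ | p', hp', hmem⟩ := h₄ i' (by omega) hlt
          · have : j = i' := by simpa using hmem
            omega
          · exact ⟨p', by omega, by simpa using hmem⟩

/-- The list of letters of a word, with parameters regarded as natural numbers. -/
def toList {n k : ℕ} (w : Fin n → α ⊕ Fin k) : List (α ⊕ ℕ) :=
  List.ofFn fun p => Sum.map id Fin.val (w p)

lemma toList_injective {n k : ℕ} :
    Function.Injective (toList : (Fin n → α ⊕ Fin k) → List (α ⊕ ℕ)) := by
  intro w w' h
  funext p
  exact Sum.map_injective.2 ⟨Function.injective_id, Fin.val_injective⟩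
    (congrFun (List.ofFn_injective h) p)

lemma toList_getElem?_eq_some {n k : ℕ} {w : Fin n → α ⊕ Fin k} {p i : ℕ} :
    (toList w)[p]? = some (Sum.inr i) ↔
      ∃ (hp : p < n) (hi : i < k), w ⟨p, hp⟩ = Sum.inr ⟨i, hi⟩ := by
  rw [toList, List.getElem?_ofFn]
  by_cases hp : p < n
  · rw [dif_pos hp]
    rcases h : w ⟨p, hp⟩ with a | i'
    · simp [h]
    · simp only [Sum.map_inr, Option.some.injEq, Sum.inr.injEq, exists_prop_of_true hp, h]
      refine ⟨?_, ?_⟩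
      · rintro rfl
        exact ⟨i'.2, rfl⟩
      · rintro ⟨hi, rfl⟩
        rfl
  · simp [hp]

lemma exists_lt_mem_of_sInf_lt_sInf {S T : Set ℕ} (h : sInf S < sInf T) (hS : S.Nonempty) {p : ℕ}
    (hp : p ∈ T) : ∃ p' < p, p' ∈ S :=
  ⟨sInf S, h.trans_le (Nat.sInf_le hp), Nat.sInf_mem hS⟩

lemma sInf_lt_sInf {S T : Set ℕ} (hT : T.Nonempty) (h : ∀ p ∈ T, ∃ p' < p, p' ∈ S) :
    sInf S < sInf T :=
  let ⟨_, hlt, hS⟩ := h _ (Nat.sInf_mem hT)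
  (Nat.sInf_le hS).trans_lt hlt

lemma isPW_iff_paramList {n k : ℕ} {w : Fin n → α ⊕ Fin k} :
    IsPW α n k w ↔ ParamList k 0 (toList w) := by
  simp only [paramList_iff, toList_getElem?_eq_some, IsPW, Nat.zero_le, true_and, true_imp_iff]
  constructor
  · rintro ⟨h₁, h₂⟩
    refine ⟨fun i hi => ?_, ?_⟩
    · obtain ⟨p, hp⟩ := h₁ ⟨i, hi⟩
      exact ⟨p, p.2, hi, hp⟩
    · rintro p i ⟨hp, hi, h⟩
      refine ⟨hi, fun i' hi' => ?_⟩
      have hlt := h₂ ⟨i', hi'.trans hi⟩ ⟨i, hi⟩ hi'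
      obtain ⟨q, hq⟩ := h₁ ⟨i', hi'.trans hi⟩
      obtain ⟨p', hp', hn, h'⟩ :=
        exists_lt_mem_of_sInf_lt_sInf hlt ⟨q, q.2, hq⟩ (p := p) ⟨hp, h⟩
      exact ⟨p', hp', hn, _, h'⟩
  · rintro ⟨h₁, h₂⟩
    refine ⟨fun i => ?_, fun i j hij => ?_⟩
    · obtain ⟨p, hp, hi, h⟩ := h₁ i i.2
      exact ⟨⟨p, hp⟩, h⟩
    · obtain ⟨q, hq, hj, h'⟩ := h₁ j j.2
      refine sInf_lt_sInf ⟨q, hq, h'⟩ ?_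
      rintro r ⟨hr, hrj⟩
      obtain ⟨p', hp', hn, _, h''⟩ := (h₂ r j ⟨hr, j.2, hrj⟩).2 i hij
      exact ⟨p', hp', hn, h''⟩

lemma exists_toList_eq {n k : ℕ} {w : List (α ⊕ ℕ)} (hn : w.length = n)
    (hw : ∀ x ∈ w, isLetter k x = true) : ∃ w' : Fin n → α ⊕ Fin k, toList w' = w := by
  subst hn
  have : ∀ p : Fin w.length, ∃ x : α ⊕ Fin k, Sum.map id Fin.val x = w.get p := by
    intro p
    have hp := hw _ (List.get_mem w p)
    rcases h : w.get p with a | i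
    · exact ⟨Sum.inl a, rfl⟩
    · rw [h] at hp
      exact ⟨Sum.inr ⟨i, by simpa using hp⟩, rfl⟩
  choose w' hw' using this
  exact ⟨w', by rw [toList, funext hw', List.ofFn_get]⟩

lemma toList_compPW {n m k : ℕ} (u : Fin n → α ⊕ Fin m) (v : Fin m → α ⊕ Fin k) :
    toList (compPW u v) = (toList u).map (subst 0 (toList v)) := by
  conv_rhs => rw [toList.eq_def u, List.map_ofFn]
  refine congrArg List.ofFn ?_
  funext p
  rw [Function.comp_apply, compPW]
  rcases u p with a | i
  · rfl
  · simp [subst, toList]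

end GrahamRothschild

/-- The Graham–Rothschild theorem. -/
theorem stmt_15 (α : Type) (hα : Finite α) (m ℓ k : ℕ)
    (hm : 1 ≤ m) (hℓ : 1 ≤ ℓ) (hk : 2 ≤ k) :
    ∃ n : ℕ, ∀ χ : {w : Fin n → α ⊕ Fin ℓ // IsPW α n ℓ w} → Fin k,
      ∃ u : Fin n → α ⊕ Fin m, IsPW α n m u ∧ ∃ j : Fin k,
        ∀ v : Fin m → α ⊕ Fin ℓ, IsPW α m ℓ v →
          ∀ h : IsPW α n ℓ (compPW u v), χ ⟨compPW u v, h⟩ = j := by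
  classical
  obtain ⟨n, hn⟩ := GrahamRothschild.grahamRothschildAt (α := α) ℓ 0 m (Fin k)
  refine ⟨n, fun χ => ?_⟩
  let f : {w : Fin n → α ⊕ Fin ℓ // IsPW α n ℓ w} → List (α ⊕ ℕ) :=
    fun w => GrahamRothschild.toList w.1
  have hf : Function.Injective f :=
    GrahamRothschild.toList_injective.comp Subtype.val_injective
  obtain ⟨u, hun, hu, c, hc⟩ := hn (Function.extend f χ fun _ => ⟨0, by omega⟩)
  rw [zero_add] at hu
  obtain ⟨u', rfl⟩ := GrahamRothschild.exists_toList_eq hun hu.forall_isLetter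
  refine ⟨u', GrahamRothschild.isPW_iff_paramList.2 hu, c, fun v hv h => ?_⟩
  rw [← hc (GrahamRothschild.toList v) (by simp [GrahamRothschild.toList])
    (by rw [zero_add]; exact GrahamRothschild.isPW_iff_paramList.1 hv),
    ← GrahamRothschild.toList_compPW]
  exact (hf.extend_apply χ _ ⟨compPW u' v, h⟩).symm
end
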